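/- There exists a sequence x_1, x_2, ..., x_1160 with each x_i ∈ {+1, −1} whose discrepancy is at most 2; that is, for every positive integer d and every positive integer k with k·d ≤ 1160, the absolute value of the sum x_d + x_{2d} + x_{3d} + ... + x_{kd} is at most 2. -/

import Mathlib

/-- The positions `i` at which the sequence takes the value `1`, encoded as the binary digits of a
natural number. -/
def signBits : ℕ :=
  8291203351207448939202765941843184141235203093933967971411067917422971323622543310480012112903810734439239097975974204784766104333339391772808375584881909548365693300270752490838179100321257195571060008316116566326265930416470092840462258644257278866899167047827689402617283538453466606347048420986966572122017723313488235703686536278314823428449490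

/-- The sequence with value `1` at the nonzero binary digits of `b` and `-1` elsewhere. -/
def signOfBits (b i : ℕ) : ℤ := if b.testBit i then 1 else -1

/-- Whether a walk that starts at `s`, with steps `signOfBits b i, signOfBits b (i + d), …`,
stays in `[-2, 2]` for its first `n` steps. -/
def walkStaysBounded (b d : ℕ) : ℕ → ℕ → ℤ → Bool
  | 0, _, _ => true
  | n + 1, i, s =>
    bif b.testBit i then decide (s + 1 ≤ 2) && walkStaysBounded b d n (i + d) (s + 1)
    else decide (-2 ≤ s - 1) && walkStaysBounded b d n (i + d) (s - 1)

theorem abs_add_sum_le_two_of_walkStaysBounded {b d n : ℕ} {i : ℕ} {s : ℤ}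
    (h : walkStaysBounded b d n i s = true) (hs : |s| ≤ 2) {k : ℕ} (hk : k ≤ n) :
    |s + ∑ j ∈ Finset.range k, signOfBits b (i + j * d)| ≤ 2 := by
  induction n generalizing i s k with
  | zero => simpa [Nat.le_zero.mp hk] using hs
  | succ n ih =>
    cases k with
    | zero => simpa using hs
    | succ k =>
      have hshift (j : ℕ) : i + (j + 1) * d = i + d + j * d := by ring
      rw [Finset.sum_range_succ', add_comm (∑ _ ∈ _, _), ← add_assoc]
      simp only [hshift, zero_mul, add_zero]
      rw [abs_le] at hs
      cases hb : b.testBit i <;>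
        simp only [walkStaysBounded, hb, cond_true, cond_false, Bool.and_eq_true,
          decide_eq_true_eq] at h
      · have hi : signOfBits b i = -1 := by simp [signOfBits, hb]
        rw [hi, ← sub_eq_add_neg]
        exact ih h.2 (abs_le.mpr ⟨h.1, by linarith⟩) (by omega)
      · have hi : signOfBits b i = 1 := by simp [signOfBits, hb]
        rw [hi]
        exact ih h.2 (abs_le.mpr ⟨by linarith, h.1⟩) (by omega)

theorem walkStaysBounded_signBits :
    ∀ d < 1161, walkStaysBounded signBits d (1160 / d) d 0 = true := by
  decide +kernel

/-- There exists a ±1 sequence of length 1160 with discrepancy at most 2. -/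
theorem edp_exists_length_1160_discrepancy_le_two :
    ∃ x : ℕ → ℤ, (∀ i, 1 ≤ i → i ≤ 1160 → x i = 1 ∨ x i = -1) ∧
      ∀ d k : ℕ, 0 < d → 0 < k → k * d ≤ 1160 →
        |∑ i ∈ Finset.Icc 1 k, x (i * d)| ≤ 2 := by
  refine ⟨signOfBits signBits, fun i _ _ => ite_eq_or_eq _ _ _, fun d k hd hk hkd => ?_⟩
  have hd' : d < 1161 := Nat.lt_succ_of_le ((Nat.le_mul_of_pos_left d hk).trans hkd)
  have h := abs_add_sum_le_two_of_walkStaysBounded (walkStaysBounded_signBits d hd') (by simp)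
    ((Nat.le_div_iff_mul_le hd).mpr hkd)
  rw [← Finset.Ico_succ_right_eq_Icc, Finset.sum_Ico_eq_sum_range]
  simpa [add_mul] using h
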